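/- arXiv:2503.02820 — 2 statements merged into one kernel-verified Lean document; each statement's English description precedes it below -/
import Mathlib

section
/- (SE₂(3) substructure) Let φ, ν, ρ ∈ ℝ³, and let ξ^∧ denote the 5×5 real matrix whose top-left 3×3 block is φ^∧, whose fourth and fifth columns have top 3×1 blocks ν and ρ respectively, and whose last two rows are zero. Then for every ℓ ∈ ℕ, Γ_ℓ(ξ^∧) is the 5×5 matrix whose top-left 3×3 block is Γ_ℓ(φ^∧), whose fourth and fifth columns have top 3×1 blocks Γ_{ℓ+1}(φ^∧)·ν and Γ_{ℓ+1}(φ^∧)·ρ respectively, whose bottom-right 2×2 block is (1/ℓ!) times the 2×2 identity, and whose remaining entries are zero. -/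
/-- The hat (skew-symmetric) map on `ℝ³`. -/
def hat (φ : Fin 3 → ℝ) : Matrix (Fin 3) (Fin 3) ℝ :=
  !![0, -φ 2, φ 1; φ 2, 0, -φ 0; -φ 1, φ 0, 0]

/-- `Γ_ℓ(X) = ∑_{m=0}^∞ X^m / (ℓ+m)!` for a square real matrix. -/
noncomputable def Gamma {n : Type*} [Fintype n] [DecidableEq n]
    (ℓ : ℕ) (X : Matrix n n ℝ) : Matrix n n ℝ :=
  ∑' m : ℕ, (((ℓ + m).factorial : ℝ))⁻¹ • X ^ m

/-- The `3 × 2` matrix whose two columns are the vectors `a` and `b`. -/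
def twoCols (a b : Fin 3 → ℝ) : Matrix (Fin 3) (Fin 2) ℝ :=
  Matrix.of fun i j => ![a, b] j i

open Matrix in
theorem fromBlocks_zero_pow_succ {m n R : Type*} [Fintype m] [DecidableEq m] [Fintype n]
    [DecidableEq n] [Semiring R] (A : Matrix m m R) (B : Matrix m n R) (k : ℕ) :
    (fromBlocks A B 0 0) ^ (k + 1) = fromBlocks (A ^ (k + 1)) (A ^ k * B) 0 (0 : Matrix n n R) := by
  induction k with
  | zero => simp
  | succ k ih => rw [pow_succ, ih, fromBlocks_multiply]; simp [pow_succ]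

open Matrix in
theorem HasSum.matrix_fromBlocks {ι l m n o R : Type*} [AddCommMonoid R] [TopologicalSpace R]
    {f : ι → Matrix n l R} {g : ι → Matrix n m R} {h : ι → Matrix o l R} {k : ι → Matrix o m R}
    {A : Matrix n l R} {B : Matrix n m R} {C : Matrix o l R} {D : Matrix o m R}
    (hf : HasSum f A) (hg : HasSum g B) (hh : HasSum h C) (hk : HasSum k D) :
    HasSum (fun i => fromBlocks (f i) (g i) (h i) (k i)) (fromBlocks A B C D) := by
  refine Pi.hasSum.2 fun i => Pi.hasSum.2 fun j => ?_
  rcases i with i | i <;> rcases j with j | j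
  · exact Pi.hasSum.1 (Pi.hasSum.1 hf i) j
  · exact Pi.hasSum.1 (Pi.hasSum.1 hg i) j
  · exact Pi.hasSum.1 (Pi.hasSum.1 hh i) j
  · exact Pi.hasSum.1 (Pi.hasSum.1 hk i) j

attribute [local instance] Matrix.linftyOpNormedRing Matrix.linftyOpNormedAlgebra in
theorem hasSum_Gamma {n : Type*} [Fintype n] [DecidableEq n] (ℓ : ℕ) (X : Matrix n n ℝ) :
    HasSum (fun m : ℕ => (((ℓ + m).factorial : ℝ))⁻¹ • X ^ m) (Gamma ℓ X) := by
  refine Summable.hasSum ?_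
  refine Summable.of_norm_bounded (NormedSpace.norm_expSeries_summable' (𝕂 := ℝ) X) fun m => ?_
  rw [norm_smul, norm_smul]
  gcongr ?_ * _
  rw [Real.norm_of_nonneg (by positivity), Real.norm_of_nonneg (by positivity)]
  gcongr
  exact Nat.le_add_left m ℓ

open Matrix in
theorem Gamma_fromBlocks_zero {m n : Type*} [Fintype m] [DecidableEq m] [Fintype n]
    [DecidableEq n] (ℓ : ℕ) (A : Matrix m m ℝ) (B : Matrix m n ℝ) :
    Gamma ℓ (fromBlocks A B 0 0) =
      fromBlocks (Gamma ℓ A) (Gamma (ℓ + 1) A * B) 0 ((ℓ.factorial : ℝ)⁻¹ • 1) := by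
  refine (hasSum_Gamma ℓ _).unique ?_
  rw [← hasSum_nat_add_iff' 1]
  have hA := (hasSum_nat_add_iff' 1).2 (hasSum_Gamma ℓ A)
  have hB := (hasSum_Gamma (ℓ + 1) A).map (addMonoidHomMulRight B)
    (continuous_id.matrix_mul continuous_const)
  have hterm (k : ℕ) :
      ((ℓ + (k + 1)).factorial : ℝ)⁻¹ • fromBlocks A B 0 (0 : Matrix n n ℝ) ^ (k + 1) =
      fromBlocks (((ℓ + (k + 1)).factorial : ℝ)⁻¹ • A ^ (k + 1))
        ((((ℓ + 1 + k).factorial : ℝ)⁻¹ • A ^ k) * B) 0 0 := by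
    rw [fromBlocks_zero_pow_succ, fromBlocks_smul, Matrix.smul_mul, add_right_comm ℓ 1 k, add_assoc]
    simp
  have hsum : fromBlocks (Gamma ℓ A) (Gamma (ℓ + 1) A * B) 0 ((ℓ.factorial : ℝ)⁻¹ • 1) -
      ∑ i ∈ Finset.range 1, ((ℓ + i).factorial : ℝ)⁻¹ • fromBlocks A B 0 (0 : Matrix n n ℝ) ^ i =
      fromBlocks (Gamma ℓ A - ∑ i ∈ Finset.range 1, ((ℓ + i).factorial : ℝ)⁻¹ • A ^ i)
        (Gamma (ℓ + 1) A * B) 0 0 := by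
    rw [Finset.sum_range_one, Finset.sum_range_one, pow_zero, ← fromBlocks_one, fromBlocks_smul,
      sub_eq_add_neg, fromBlocks_neg, fromBlocks_add]
    simp [sub_eq_add_neg]
  simp_rw [hterm]
  rw [hsum]
  exact hA.matrix_fromBlocks hB hasSum_zero hasSum_zero

theorem mul_twoCols (M : Matrix (Fin 3) (Fin 3) ℝ) (a b : Fin 3 → ℝ) :
    M * twoCols a b = twoCols (M.mulVec a) (M.mulVec b) := by
  ext i j
  fin_cases j <;> rfl

theorem se23_substructure (φ ν ρ : Fin 3 → ℝ) (ℓ : ℕ) :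
    Gamma ℓ (Matrix.fromBlocks (hat φ) (twoCols ν ρ) 0 0) =
      Matrix.fromBlocks (Gamma ℓ (hat φ))
        (twoCols ((Gamma (ℓ + 1) (hat φ)).mulVec ν) ((Gamma (ℓ + 1) (hat φ)).mulVec ρ))
        0 ((ℓ.factorial : ℝ)⁻¹ • 1) := by
  rw [Gamma_fromBlocks_zero, mul_twoCols]
end

section
/- (ℓ = 0 relationship, SO(3) case) For all φ, ρ ∈ ℝ³, the 3×3 matrix identity Γ₀(φ^∧, ρ^∧, φ^∧) = (Γ₁(φ^∧)·ρ)^∧ · Γ₀(φ^∧) holds; that is, ∑_{m=0}^∞ ∑_{n=0}^∞ (1/(m+n+1)!) (φ^∧)^m ρ^∧ (φ^∧)^n = (Γ₁(φ^∧)·ρ)^∧ · exp(φ^∧). -/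
/-- `Γ_ℓ(X, Y, Z) = ∑_{m=0}^∞ ∑_{n=0}^∞ X^m Y Z^n / (ℓ+m+n+1)!` for square real matrices. -/
noncomputable def Gamma3 {n : Type*} [Fintype n] [DecidableEq n]
    (ℓ : ℕ) (X Y Z : Matrix n n ℝ) : Matrix n n ℝ :=
  ∑' m : ℕ, ∑' k : ℕ, (((ℓ + m + k + 1).factorial : ℝ))⁻¹ • (X ^ m * Y * Z ^ k)

open Finset in
/-- Expansion of `∑ X ^ i * Y * X ^ j` over `i + j = N` in terms of iterated commutators
`A p = ad_X ^ p (Y)`. -/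
theorem sum_antidiagonal_pow_mul_mul_pow {R : Type*} [Ring R] (X : R) (A : ℕ → R)
    (hA : ∀ p, A (p + 1) = X * A p - A p * X) (N : ℕ) :
    ∑ ij ∈ antidiagonal N, X ^ ij.1 * A 0 * X ^ ij.2 =
      ∑ pq ∈ antidiagonal N, (N + 1).choose (pq.1 + 1) • (A pq.1 * X ^ pq.2) := by
  have hXA : ∀ p, X * A p = A (p + 1) + A p * X := fun p => by rw [hA]; abel
  induction N with
  | zero => simp
  | succ N ih =>
    have hpascal : ∀ pq : ℕ × ℕ, (N + 1 + 1).choose (pq.1 + 1) • (A pq.1 * X ^ pq.2) =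
        (N + 1).choose pq.1 • (A pq.1 * X ^ pq.2) +
          (N + 1).choose (pq.1 + 1) • (A pq.1 * X ^ pq.2) := fun pq => by
      rw [Nat.choose_succ_succ, add_nsmul]
    have hleft : ∑ ij ∈ antidiagonal N, X ^ (ij.1 + 1) * A 0 * X ^ ij.2 =
        X * ∑ ij ∈ antidiagonal N, X ^ ij.1 * A 0 * X ^ ij.2 := by
      rw [mul_sum]
      exact sum_congr rfl fun ij _ => by rw [pow_succ']; simp only [mul_assoc]
    rw [Nat.sum_antidiagonal_succ, hleft, ih, sum_congr rfl fun pq _ => hpascal pq,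
      sum_add_distrib, Nat.sum_antidiagonal_succ, Nat.sum_antidiagonal_succ', mul_sum]
    have hterm : ∀ pq : ℕ × ℕ, X * (N + 1).choose (pq.1 + 1) • (A pq.1 * X ^ pq.2) =
        (N + 1).choose (pq.1 + 1) • (A (pq.1 + 1) * X ^ pq.2) +
          (N + 1).choose (pq.1 + 1) • (A pq.1 * X ^ (pq.2 + 1)) := fun pq => by
      rw [mul_smul_comm, ← mul_assoc, hXA, add_mul, nsmul_add, pow_succ', mul_assoc (A pq.1)]
    rw [sum_congr rfl fun pq _ => hterm pq, sum_add_distrib]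
    simp
    abel

section BanachAlgebra

variable {𝔸 : Type*} [NormedRing 𝔸] [NormedAlgebra ℝ 𝔸]

theorem summable_norm_inv_factorial_smul_pow_mul_mul_pow (X Y : 𝔸) :
    Summable fun mn : ℕ × ℕ =>
      ‖(((mn.1 + mn.2 + 1).factorial : ℝ))⁻¹ • (X ^ mn.1 * Y * X ^ mn.2)‖ := by
  have hX := NormedSpace.norm_expSeries_summable' (𝕂 := ℝ) X
  have hprod := ((hX.mul_right ‖Y‖).mul_of_nonneg hX (fun _ => by positivity)
    (fun _ => by positivity))
  refine Summable.of_nonneg_of_le (fun _ => norm_nonneg _) (fun mn => ?_) hprod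
  obtain ⟨m, n⟩ := mn
  have hfac : ((m + n + 1).factorial : ℝ)⁻¹ ≤ (m.factorial : ℝ)⁻¹ * (n.factorial : ℝ)⁻¹ := by
    rw [← mul_inv]
    refine inv_anti₀ (by positivity) ?_
    exact_mod_cast (Nat.le_of_dvd (Nat.factorial_pos _)
      (Nat.factorial_mul_factorial_dvd_factorial_add m n)).trans
        (Nat.factorial_le (Nat.le_succ _))
  simp only [norm_smul, norm_inv, Real.norm_natCast]
  calc ((m + n + 1).factorial : ℝ)⁻¹ * ‖X ^ m * Y * X ^ n‖
      ≤ ((m.factorial : ℝ)⁻¹ * (n.factorial : ℝ)⁻¹) * (‖X ^ m‖ * ‖Y‖ * ‖X ^ n‖) := by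
        gcongr
        exact (norm_mul_le _ _).trans (by gcongr; exact norm_mul_le _ _)
    _ = _ := by ring

theorem summable_norm_inv_factorial_smul_iterated_commutator (X : 𝔸) (A : ℕ → 𝔸)
    (hA : ∀ p, A (p + 1) = X * A p - A p * X) :
    Summable fun p : ℕ => ‖(((1 + p).factorial : ℝ))⁻¹ • A p‖ := by
  have hbound : ∀ p, ‖A p‖ ≤ (2 * ‖X‖) ^ p * ‖A 0‖ := by
    intro p
    induction p with
    | zero => simp
    | succ p ih =>
      calc ‖A (p + 1)‖ ≤ ‖X‖ * ‖A p‖ + ‖A p‖ * ‖X‖ := by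
            rw [hA]
            exact norm_sub_le_of_le (norm_mul_le _ _) (norm_mul_le _ _)
        _ = 2 * ‖X‖ * ‖A p‖ := by ring
        _ ≤ 2 * ‖X‖ * ((2 * ‖X‖) ^ p * ‖A 0‖) := by gcongr
        _ = _ := by ring
  refine Summable.of_nonneg_of_le (fun _ => norm_nonneg _) (fun p => ?_)
    ((Real.summable_pow_div_factorial (2 * ‖X‖)).mul_right ‖A 0‖)
  have hfac : ((1 + p).factorial : ℝ)⁻¹ ≤ (p.factorial : ℝ)⁻¹ :=
    inv_anti₀ (by positivity) (by exact_mod_cast Nat.factorial_le (Nat.le_add_left p 1))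
  rw [norm_smul, norm_inv, Real.norm_natCast]
  calc ((1 + p).factorial : ℝ)⁻¹ * ‖A p‖
      ≤ (p.factorial : ℝ)⁻¹ * ((2 * ‖X‖) ^ p * ‖A 0‖) := by gcongr; exact hbound p
    _ = _ := by ring

theorem tsum_tsum_inv_factorial_smul_pow_mul_mul_pow [CompleteSpace 𝔸] (X : 𝔸) (A : ℕ → 𝔸)
    (hA : ∀ p, A (p + 1) = X * A p - A p * X) :
    ∑' m : ℕ, ∑' n : ℕ, (((m + n + 1).factorial : ℝ))⁻¹ • (X ^ m * A 0 * X ^ n) =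
      (∑' p : ℕ, (((1 + p).factorial : ℝ))⁻¹ • A p) *
        ∑' q : ℕ, ((q.factorial : ℝ))⁻¹ • X ^ q := by
  have hs := (summable_norm_inv_factorial_smul_pow_mul_mul_pow X (A 0)).of_norm
  have hs_sigma := (Finset.HasAntidiagonal.sigmaAntidiagonalEquivProd (A := ℕ)).summable_iff.mpr hs
  simp only [Function.comp_def] at hs_sigma
  rw [tsum_mul_tsum_eq_tsum_sum_antidiagonal_of_summable_norm
    (summable_norm_inv_factorial_smul_iterated_commutator X A hA)
    (NormedSpace.norm_expSeries_summable' (𝕂 := ℝ) X), ← hs.tsum_prod,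
    ← (Finset.HasAntidiagonal.sigmaAntidiagonalEquivProd (A := ℕ)).tsum_eq,
    hs_sigma.tsum_sigma]
  refine tsum_congr fun N => ?_
  rw [tsum_fintype]
  have hcoe := Finset.sum_coe_sort (Finset.HasAntidiagonal.antidiagonal N) fun mn : ℕ × ℕ =>
    (((mn.1 + mn.2 + 1).factorial : ℝ))⁻¹ • (X ^ mn.1 * A 0 * X ^ mn.2)
  refine hcoe.trans ?_
  calc _ = (((N + 1).factorial : ℝ))⁻¹ •
        ∑ mn ∈ Finset.HasAntidiagonal.antidiagonal N, X ^ mn.1 * A 0 * X ^ mn.2 := by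
        rw [Finset.smul_sum]
        exact Finset.sum_congr rfl fun mn h => by rw [Finset.HasAntidiagonal.mem_antidiagonal.mp h]
    _ = _ := by
        rw [sum_antidiagonal_pow_mul_mul_pow X A hA, Finset.smul_sum]
        refine Finset.sum_congr rfl fun pq h => ?_
        obtain ⟨p, q⟩ := pq
        obtain rfl : p + q = N := Finset.HasAntidiagonal.mem_antidiagonal.mp h
        rw [smul_mul_smul_comm, ← Nat.cast_smul_eq_nsmul ℝ, smul_smul]
        congr 1
        have hc : (((p + q + 1).choose (p + 1) : ℕ) : ℝ) * (p + 1).factorial * q.factorial =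
            (p + q + 1).factorial := by
          rw [show p + q + 1 = p + 1 + q by ring, Nat.choose_symm_add]
          exact_mod_cast Nat.add_choose_mul_factorial_mul_factorial (p + 1) q
        rw [add_comm 1 p, ← hc]
        have : (((p + q + 1).choose (p + 1) : ℕ) : ℝ) ≠ 0 := by
          exact_mod_cast (Nat.choose_pos (by omega)).ne'
        field_simp

theorem summable_inv_factorial_one_add_smul_pow [CompleteSpace 𝔸] (X : 𝔸) :
    Summable fun m : ℕ => (((1 + m).factorial : ℝ))⁻¹ • X ^ m := by
  refine Summable.of_norm_bounded (NormedSpace.norm_expSeries_summable' (𝕂 := ℝ) X) fun m => ?_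
  simp only [norm_smul, norm_inv, Real.norm_natCast]
  gcongr
  exact Nat.le_add_left m 1

end BanachAlgebra

/-- The hat map as a linear map. -/
def hatLinearMap : (Fin 3 → ℝ) →ₗ[ℝ] Matrix (Fin 3) (Fin 3) ℝ where
  toFun := hat
  map_add' x y := by
    ext i j
    fin_cases i <;> fin_cases j <;> simp [hat] <;> ring
  map_smul' c x := by
    ext i j
    fin_cases i <;> fin_cases j <;> simp [hat]

/-- The hat map intertwines the cross product with the commutator. -/
theorem hat_hat_mulVec (φ ρ : Fin 3 → ℝ) :
    hat ((hat φ).mulVec ρ) = hat φ * hat ρ - hat ρ * hat φ := by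
  ext i j
  fin_cases i <;> fin_cases j <;>
    simp [hat, Matrix.mulVec, dotProduct, Fin.sum_univ_three] <;> ring

attribute [local instance] Matrix.linftyOpNormedRing Matrix.linftyOpNormedAlgebra in
theorem gamma3_zero_eq (φ ρ : Fin 3 → ℝ) :
    Gamma3 0 (hat φ) (hat ρ) (hat φ) =
      hat ((Gamma 1 (hat φ)).mulVec ρ) * Gamma 0 (hat φ) := by
  let L : Matrix (Fin 3) (Fin 3) ℝ →ₗ[ℝ] Matrix (Fin 3) (Fin 3) ℝ :=
    hatLinearMap ∘ₗ (Matrix.mulVecBilin ℝ ℝ).flip ρ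
  have hL : ∀ M, L M = hat (M.mulVec ρ) := fun _ => rfl
  have hsum : hat ((Gamma 1 (hat φ)).mulVec ρ) =
      ∑' p : ℕ, (((1 + p).factorial : ℝ))⁻¹ • L (hat φ ^ p) := by
    have h := L.toContinuousLinearMap.map_tsum (summable_inv_factorial_one_add_smul_pow (hat φ))
    simp only [map_smul, LinearMap.coe_toContinuousLinearMap'] at h
    exact h
  have key := tsum_tsum_inv_factorial_smul_pow_mul_mul_pow (hat φ) (fun p => L (hat φ ^ p))
    fun p => by rw [hL, hL, pow_succ', ← Matrix.mulVec_mulVec, hat_hat_mulVec]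
  have h0 : L (hat φ ^ 0) = hat ρ := by rw [hL, pow_zero, Matrix.one_mulVec]
  rw [hsum]
  simp only [h0] at key
  simp only [Gamma3, Gamma, zero_add]
  exact key
end
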